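/- Let β, β̃ ∈ (0,1) with β + 2β̃ > 1. For any divergence-free v ∈ C^β([0,T]×𝕋³; ℝ³), the transport equation ∂_t ρ + div(vρ) = 0 with given initial data ρ(0) = ρ₀ admits at most one weak solution ρ ∈ C^{β̃}([0,T]×𝕋³). -/

import Mathlib

open MeasureTheory
open scoped BigOperators NNReal ENNReal

noncomputable section

/-- Points of `ℝ³`; periodic functions on it represent functions on the torus `𝕋³`. -/
abbrev V3 := Fin 3 → ℝ

/-- Partial derivative `∂ᵢ f` of a scalar function on `ℝ³`. -/
noncomputable def pd (i : Fin 3) (f : V3 → ℝ) (x : V3) : ℝ :=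
  fderiv ℝ f x (Pi.single i 1)

/-- Gradient of a scalar function on `ℝ³`. -/
noncomputable def grad3 (f : V3 → ℝ) (x : V3) : V3 := fun i => pd i f x

/-- Euclidean inner product on `ℝ³`. -/
def dot3 (a b : V3) : ℝ := ∑ i, a i * b i

/-- `ℤ³`-periodicity of a scalar function on `ℝ³` (i.e. it descends to `𝕋³ = ℝ³/ℤ³`). -/
def ZPer (f : V3 → ℝ) : Prop :=
  ∀ (x : V3) (n : Fin 3 → ℤ), f (x + fun i => (n i : ℝ)) = f x

/-- `ℤ³`-periodicity (in space) of a space-time scalar function. -/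
def ZPerST (f : ℝ × V3 → ℝ) : Prop :=
  ∀ (t : ℝ) (x : V3) (n : Fin 3 → ℤ), f (t, x + fun i => (n i : ℝ)) = f (t, x)

/-- `ℤ³`-periodicity (in space) of a space-time vector field. -/
def ZPerSTv (v : ℝ × V3 → V3) : Prop :=
  ∀ (t : ℝ) (x : V3) (n : Fin 3 → ℤ), v (t, x + fun i => (n i : ℝ)) = v (t, x)

/-- `v(t, ·)` is divergence-free in the distributional sense on `𝕋³`, for every `t`:
tested against smooth periodic test functions over the fundamental domain `[0,1]³`. -/
def WeaklyDivFree (v : ℝ × V3 → V3) : Prop :=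
  ∀ (t : ℝ) (φ : V3 → ℝ), ContDiff ℝ (⊤ : ℕ∞) φ → ZPer φ →
    ∫ x in Set.Icc (0 : V3) 1, dot3 (v (t, x)) (grad3 φ x) = 0

/-- `ρ` is a weak (distributional) solution on `[0,T] × 𝕋³` of the transport equation
`∂_t ρ + div (v ρ) = 0` : for every smooth spatially periodic test function `φ` and every
`t ∈ [0,T]`,
`∫₀ᵗ ∫ (ρ ∂_s φ + ρ v·∇φ) dx ds = ∫ ρ(t) φ(t) dx − ∫ ρ(0) φ(0) dx`. -/
def IsWeakTransportSol (T : ℝ) (v : ℝ × V3 → V3) (ρ : ℝ × V3 → ℝ) : Prop :=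
  ∀ φ : ℝ × V3 → ℝ, ContDiff ℝ (⊤ : ℕ∞) φ → ZPerST φ →
    ∀ t ∈ Set.Icc (0 : ℝ) T,
      (∫ s in (0:ℝ)..t, ∫ x in Set.Icc (0 : V3) 1,
          (ρ (s, x) * deriv (fun r => φ (r, x)) s
            + ρ (s, x) * dot3 (v (s, x)) (grad3 (fun y => φ (s, y)) x)))
        = (∫ x in Set.Icc (0 : V3) 1, ρ (t, x) * φ (t, x))
          - ∫ x in Set.Icc (0 : V3) 1, ρ (0, x) * φ (0, x)


/-- Integrals over the unit cube of periodic functions are translation invariant. -/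
lemma ZPer.setIntegral_add {f : V3 → ℝ} (hf : ZPer f) (z : V3) :
    ∫ x in Set.Icc (0 : V3) 1, f (x + z) = ∫ x in Set.Icc (0 : V3) 1, f x := by
  have hIco : (Set.Icc (0 : V3) 1) =ᵐ[volume] ZSpan.fundamentalDomain (Pi.basisFun ℝ (Fin 3)) := by
    rw [ZSpan.fundamentalDomain_pi_basisFun]
    exact (Measure.univ_pi_Ico_ae_eq_Icc (f := fun _ : Fin 3 => (0 : ℝ))
      (g := fun _ : Fin 3 => (1 : ℝ))).symm
  have hD := ZSpan.isAddFundamentalDomain' (Pi.basisFun ℝ (Fin 3)) (volume : Measure V3)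
  have hDz := hD.vadd_of_comm (G' := V3) z
  have hinv : ∀ (g : (Submodule.span ℤ (Set.range (Pi.basisFun ℝ (Fin 3)))).toAddSubgroup)
      (x : V3), f (g +ᵥ x) = f x := by
    intro g x
    have hg : (g : V3) ∈ Submodule.span ℤ (Set.range (Pi.basisFun ℝ (Fin 3))) := g.2
    rw [Module.Basis.mem_span_iff_repr_mem] at hg
    choose n hn using hg
    have : (g +ᵥ x : V3) = x + fun i => (n i : ℝ) := by
      ext i
      have := hn i
      simp at this
      simp [AddSubgroup.vadd_def, this, add_comm]
    rw [this, hf]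
  have : Countable (Submodule.span ℤ (Set.range (Pi.basisFun ℝ (Fin 3)))).toAddSubgroup :=
    inferInstanceAs (Countable (Submodule.span ℤ (Set.range (Pi.basisFun ℝ (Fin 3)))))
  rw [setIntegral_congr_set hIco, setIntegral_congr_set hIco, hD.setIntegral_eq hDz hinv]
  have hmp : MeasurePreserving (fun x : V3 => z + x) volume volume :=
    measurePreserving_add_left volume z
  have := hmp.setIntegral_image_emb (MeasurableEquiv.addLeft z).measurableEmbedding f
    (ZSpan.fundamentalDomain (Pi.basisFun ℝ (Fin 3)))
  simp_rw [add_comm _ z]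
  exact this.symm

lemma ZPer.setIntegral_sub {f : V3 → ℝ} (hf : ZPer f) (z : V3) :
    ∫ x in Set.Icc (0 : V3) 1, f (x - z) = ∫ x in Set.Icc (0 : V3) 1, f x := by
  simpa [sub_eq_add_neg] using hf.setIntegral_add (-z)

lemma ZPer.comp_sub {f : V3 → ℝ} (hf : ZPer f) (z : V3) : ZPer fun x => f (x - z) := by
  intro x n
  have := hf (x - z) n
  simp only at this ⊢
  rw [← this]
  congr 1
  abel

lemma ZPer.mul {f g : V3 → ℝ} (hf : ZPer f) (hg : ZPer g) : ZPer fun x => f x * g x :=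
  fun x n => by simp only [hf x n, hg x n]

/-- Convolution of `f` with the kernel `k`. -/
def mollify (k f : V3 → ℝ) (x : V3) : ℝ := ∫ z, k z * f (x - z)

lemma mollify_eq_convolution (k f : V3 → ℝ) :
    mollify k f = MeasureTheory.convolution k f (ContinuousLinearMap.mul ℝ ℝ) volume := rfl

lemma ZPer.mollify {f : V3 → ℝ} (hf : ZPer f) (k : V3 → ℝ) : ZPer (mollify k f) := by
  intro x n
  simp only [_root_.mollify]
  congr 1
  ext z
  exact congrArg (k z * ·) (hf.comp_sub z x n)

lemma contDiff_mollify {k f : V3 → ℝ} (hk : ContDiff ℝ (⊤ : ℕ∞) k) (hkc : HasCompactSupport k)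
    (hf : Continuous f) : ContDiff ℝ (⊤ : ℕ∞) (mollify k f) := by
  rw [mollify_eq_convolution]
  exact hkc.contDiff_convolution_left _ hk hf.locallyIntegrable

lemma continuous_pd {k : V3 → ℝ} (hk : ContDiff ℝ (⊤ : ℕ∞) k) (i : Fin 3) :
    Continuous (pd i k) :=
  (hk.continuous_fderiv (by simp)).clm_apply continuous_const

lemma hasCompactSupport_pd {k : V3 → ℝ} (hkc : HasCompactSupport k) (i : Fin 3) :
    HasCompactSupport (pd i k) :=
  hkc.fderiv_apply (𝕜 := ℝ) _

lemma pd_mollify {k f : V3 → ℝ} (hk : ContDiff ℝ (⊤ : ℕ∞) k) (hkc : HasCompactSupport k)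
    (hf : Continuous f) (i : Fin 3) (x : V3) :
    pd i (mollify k f) x = ∫ z, pd i k z * f (x - z) := by
  have h1 : ContDiff ℝ 1 k := hk.of_le (by exact_mod_cast le_top)
  have h := hkc.hasFDerivAt_convolution_left (ContinuousLinearMap.mul ℝ ℝ) (μ := volume)
    h1 hf.locallyIntegrable x
  have hex := (hkc.fderiv (𝕜 := ℝ)).convolutionExists_left
    ((ContinuousLinearMap.mul ℝ ℝ).precompL V3) (μ := volume)
    (hk.continuous_fderiv (by simp)) hf.locallyIntegrable x
  rw [pd, mollify_eq_convolution, h.fderiv, convolution_def, ContinuousLinearMap.integral_apply hex]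
  rfl

lemma pd_neg_of_even {k : V3 → ℝ} (hk : Differentiable ℝ k) (heven : ∀ x, k (-x) = k x)
    (i : Fin 3) (x : V3) : pd i k (-x) = -pd i k x := by
  have h := (hk (-x)).hasFDerivAt.comp x (hasFDerivAt_id x).neg
  have hk' : k ∘ Neg.neg = k := funext heven
  rw [hk'] at h
  simp [pd, h.fderiv]

/-- Fubini for a compactly supported kernel. -/
lemma setIntegral_integral_swap {κ : V3 → ℝ} (hκ : Continuous κ) (hκc : HasCompactSupport κ)
    {h : V3 → V3 → ℝ} (hh : Continuous (Function.uncurry h)) :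
    ∫ x in Set.Icc (0 : V3) 1, ∫ z, κ z * h x z
      = ∫ z, κ z * ∫ x in Set.Icc (0 : V3) 1, h x z := by
  rw [integral_integral_swap]
  · simp_rw [integral_const_mul]
  · have hcont : Continuous (Function.uncurry fun x z : V3 => κ z * h x z) :=
      (hκ.comp continuous_snd).mul hh
    have h1 : IntegrableOn (Function.uncurry fun x z : V3 => κ z * h x z)
        (Set.Icc (0 : V3) 1 ×ˢ tsupport κ) (volume.prod volume) :=
      hcont.continuousOn.integrableOn_compact (isCompact_Icc.prod hκc)
    have h2 : IntegrableOn (Function.uncurry fun x z : V3 => κ z * h x z)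
        (Set.Icc (0 : V3) 1 ×ˢ Set.univ) (volume.prod volume) := by
      refine h1.of_forall_sdiff_eq_zero (measurableSet_Icc.prod MeasurableSet.univ) ?_
      rintro ⟨x, z⟩ ⟨⟨hx, -⟩, hxz⟩
      have : z ∉ tsupport κ := fun hz => hxz ⟨hx, hz⟩
      simp [Function.uncurry, image_eq_zero_of_notMem_tsupport this]
    rwa [IntegrableOn, ← Measure.prod_restrict, Measure.restrict_univ] at h2

lemma integrable_mul_of_hasCompactSupport {κ g : V3 → ℝ} (hκ : Continuous κ)
    (hκc : HasCompactSupport κ) (hg : Continuous g) : Integrable fun z => κ z * g z :=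
  (hκ.mul hg).integrable_of_hasCompactSupport hκc.mul_right

lemma integrableOn_cube {g : V3 → ℝ} (hg : Continuous g) :
    IntegrableOn g (Set.Icc (0 : V3) 1) :=
  hg.continuousOn.integrableOn_compact isCompact_Icc

lemma volume_real_cube : volume.real (Set.Icc (0 : V3) 1) = 1 := by
  simp [Measure.real, Real.volume_Icc_pi]

lemma abs_setIntegral_cube_le {g : V3 → ℝ} {C : ℝ}
    (h : ∀ x ∈ Set.Icc (0 : V3) 1, |g x| ≤ C) : |∫ x in Set.Icc (0 : V3) 1, g x| ≤ C := by
  have := norm_setIntegral_le_of_norm_le_const (μ := volume) (s := Set.Icc (0 : V3) 1)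
    isCompact_Icc.measure_lt_top (f := g) (C := C) h
  rwa [volume_real_cube, mul_one] at this

lemma continuous_setIntegral_cube {X : Type*} [TopologicalSpace X] [FirstCountableTopology X]
    [LocallyCompactSpace X]
    {h : X → V3 → ℝ} (hh : Continuous (Function.uncurry h)) :
    Continuous fun z => ∫ x in Set.Icc (0 : V3) 1, h z x :=
  continuous_parametric_integral_of_continuous hh isCompact_Icc

lemma abs_integral_kernel_mul_le {κ g : V3 → ℝ} (hκ : Continuous κ) (hκc : HasCompactSupport κ)
    {ε C : ℝ} (hsupp : ∀ z, ε < ‖z‖ → κ z = 0) (hg : ∀ z, ‖z‖ ≤ ε → |g z| ≤ C) :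
    |∫ z, κ z * g z| ≤ C * ∫ z, |κ z| := by
  rw [← integral_const_mul]
  refine norm_integral_le_of_norm_le (f := fun z => κ z * g z)
    ((hκ.abs.integrable_of_hasCompactSupport (hκc.norm)).const_mul C) (ae_of_all _ fun z => ?_)
  rw [Real.norm_eq_abs, abs_mul]
  rcases le_or_gt ‖z‖ ε with hz | hz
  · rw [mul_comm]
    exact mul_le_mul_of_nonneg_right (hg z hz) (abs_nonneg _)
  · simp [hsupp z hz]

lemma integral_odd_mul_comp_neg {κ : V3 → ℝ} (hodd : ∀ z, κ (-z) = -κ z) (B : V3 → ℝ) :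
    ∫ z, κ z * B (-z) = -∫ z, κ z * B z := by
  rw [← integral_neg_eq_self, ← integral_neg]
  simp [hodd]

lemma continuous_setIntegral_mul_comp_sub {p g : V3 → ℝ} (hp : Continuous p)
    (hg : Continuous g) :
    Continuous fun z => ∫ x in Set.Icc (0 : V3) 1, p x * g (x - z) :=
  continuous_setIntegral_cube (h := fun z x => p x * g (x - z)) (by fun_prop)

/-- Pairing with the gradient of a mollification, written in terms of the gradient of the
kernel. -/
lemma setIntegral_mul_dot3_grad3_mollify {k f g : V3 → ℝ} {u : V3 → V3}
    (hk : ContDiff ℝ (⊤ : ℕ∞) k) (hkc : HasCompactSupport k)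
    (hf : Continuous f) (hg : Continuous g) (hu : Continuous u) :
    ∫ x in Set.Icc (0 : V3) 1, f x * dot3 (u x) (grad3 (mollify k g) x)
      = ∑ i, ∫ z, pd i k z * ∫ x in Set.Icc (0 : V3) 1, f x * u x i * g (x - z) := by
  have hpd : ∀ i, Continuous (pd i (mollify k g)) :=
    continuous_pd (contDiff_mollify hk hkc hg)
  simp_rw [dot3, Finset.mul_sum, grad3]
  rw [integral_finsetSum]
  · refine Finset.sum_congr rfl fun i _ => ?_
    rw [← setIntegral_integral_swap (continuous_pd hk i) (hasCompactSupport_pd hkc i)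
      (h := fun x z => f x * u x i * g (x - z)) (by fun_prop)]
    congr 1
    ext x
    rw [pd_mollify hk hkc hg, ← mul_assoc, ← integral_const_mul]
    congr 1
    ext z
    ring
  · intro i _
    have := hpd i
    exact integrableOn_cube (by fun_prop)

/-- Expansion of the trilinear increment form. -/
lemma setIntegral_sq_sub_mul_sub {f w : V3 → ℝ} (hf : Continuous f) (hw : Continuous w)
    (hfp : ZPer f) (hwp : ZPer w) (z : V3) :
    ∫ x in Set.Icc (0 : V3) 1, (f x - f (x - z)) ^ 2 * (w x - w (x - z))
      = (∫ x in Set.Icc (0 : V3) 1, w x * (f (x - z) * f (x - z)))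
        - (∫ x in Set.Icc (0 : V3) 1, w x * (f (x - -z) * f (x - -z)))
        - 2 * (∫ x in Set.Icc (0 : V3) 1, f x * w x * f (x - z))
        + 2 * (∫ x in Set.Icc (0 : V3) 1, f x * w x * f (x - -z)) := by
  have h1 : ∫ x in Set.Icc (0 : V3) 1, w x * (f (x - -z) * f (x - -z))
      = ∫ x in Set.Icc (0 : V3) 1, w (x - z) * (f x * f x) := by
    rw [← ((hwp.comp_sub z).mul (hfp.mul hfp)).setIntegral_add z]
    simp
  have h2 : ∫ x in Set.Icc (0 : V3) 1, f x * w x * f (x - -z)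
      = ∫ x in Set.Icc (0 : V3) 1, f (x - z) * w (x - z) * f x := by
    rw [← (((hfp.comp_sub z).mul (hwp.comp_sub z)).mul hfp).setIntegral_add z]
    simp
  have h3 := (hwp.mul (hfp.mul hfp)).setIntegral_sub z
  have e : ∀ x, (f x - f (x - z)) ^ 2 * (w x - w (x - z))
      = w x * (f (x - z) * f (x - z)) - w (x - z) * (f x * f x) - 2 * (f x * w x * f (x - z))
        + 2 * (f (x - z) * w (x - z) * f x)
        + w x * (f x * f x) - w (x - z) * (f (x - z) * f (x - z)) := fun x => by ring
  simp_rw [e]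
  rw [integral_sub, integral_add, integral_add, integral_sub, integral_sub, integral_const_mul,
    integral_const_mul, h3, h1, h2]
  · ring
  all_goals exact integrableOn_cube (by fun_prop)

/-- The energy flux at the scale of the kernel, expressed through increments. -/
lemma four_mul_energy_flux {k f : V3 → ℝ} {u : V3 → V3}
    (hk : ContDiff ℝ (⊤ : ℕ∞) k) (hkc : HasCompactSupport k) (heven : ∀ x, k (-x) = k x)
    (hf : Continuous f) (hu : Continuous u) (hfp : ZPer f) (hup : ∀ i, ZPer fun x => u x i)
    (hdiv : ∀ φ : V3 → ℝ, ContDiff ℝ (⊤ : ℕ∞) φ → ZPer φ →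
      ∫ x in Set.Icc (0 : V3) 1, dot3 (u x) (grad3 φ x) = 0) :
    4 * ∫ x in Set.Icc (0 : V3) 1, f x * dot3 (u x) (grad3 (mollify k f) x)
      = -∑ i, ∫ z, pd i k z *
          ∫ x in Set.Icc (0 : V3) 1, (f x - f (x - z)) ^ 2 * (u x i - u (x - z) i) := by
  have hB : ∑ i, ∫ z, pd i k z * ∫ x in Set.Icc (0 : V3) 1, u x i * (f (x - z) * f (x - z))
      = 0 := by
    have h := setIntegral_mul_dot3_grad3_mollify (f := fun _ => 1) (g := fun x => f x * f x)
      hk hkc continuous_const (hf.mul hf) hu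
    simp only [one_mul] at h
    rw [← h]
    exact hdiv _ (contDiff_mollify hk hkc (hf.mul hf)) ((hfp.mul hfp).mollify k)
  have hA := setIntegral_mul_dot3_grad3_mollify hk hkc hf hf hu
  have hD : ∀ i, ∫ z, pd i k z *
          ∫ x in Set.Icc (0 : V3) 1, (f x - f (x - z)) ^ 2 * (u x i - u (x - z) i)
      = 2 * (∫ z, pd i k z * ∫ x in Set.Icc (0 : V3) 1, u x i * (f (x - z) * f (x - z)))
        - 4 * ∫ z, pd i k z * ∫ x in Set.Icc (0 : V3) 1, f x * u x i * f (x - z) := by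
    intro i
    have hodd := pd_neg_of_even (hk.differentiable (by simp)) heven i
    have hui : Continuous fun x => u x i := by fun_prop
    simp_rw [setIntegral_sq_sub_mul_sub hf hui hfp (hup i)]
    set A : V3 → ℝ := fun z => ∫ x in Set.Icc (0 : V3) 1, f x * u x i * f (x - z)
    set B : V3 → ℝ := fun z => ∫ x in Set.Icc (0 : V3) 1, u x i * (f (x - z) * f (x - z))
    have hAc : Continuous A := continuous_setIntegral_mul_comp_sub (hf.mul hui) hf
    have hBc : Continuous B :=
      continuous_setIntegral_mul_comp_sub (g := fun x => f x * f x) hui (hf.mul hf)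
    have key : ∀ C : V3 → ℝ, Continuous C → Integrable fun z => pd i k z * C z := fun C hC =>
      integrable_mul_of_hasCompactSupport (continuous_pd hk i) (hasCompactSupport_pd hkc i) hC
    have e : ∀ z, pd i k z * (B z - B (-z) - 2 * A z + 2 * A (-z))
        = pd i k z * B z - pd i k z * B (-z) - 2 * (pd i k z * A z)
          + 2 * (pd i k z * A (-z)) := fun z => by ring
    change ∫ z, pd i k z * (B z - B (-z) - 2 * A z + 2 * A (-z))
      = 2 * (∫ z, pd i k z * B z) - 4 * ∫ z, pd i k z * A z
    simp_rw [e]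
    have i1 := key B hBc
    have i2 := key (fun z => B (-z)) (by fun_prop)
    have i3 := (key A hAc).const_mul 2
    have i4 := (key (fun z => A (-z)) (by fun_prop)).const_mul 2
    rw [integral_add, integral_sub, integral_sub i1 i2, integral_const_mul, integral_const_mul,
      integral_odd_mul_comp_neg hodd, integral_odd_mul_comp_neg hodd]
    · ring
    · exact i1.sub i2
    · exact i3
    · exact (i1.sub i2).sub i3
    · exact i4
  simp_rw [hD]
  rw [Finset.sum_sub_distrib, ← Finset.mul_sum, ← Finset.mul_sum, hB, hA]
  ring

lemma abs_energy_flux_le {k f : V3 → ℝ} {u : V3 → V3}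
    (hk : ContDiff ℝ (⊤ : ℕ∞) k) (hkc : HasCompactSupport k) (heven : ∀ x, k (-x) = k x)
    (hf : Continuous f) (hu : Continuous u) (hfp : ZPer f) (hup : ∀ i, ZPer fun x => u x i)
    (hdiv : ∀ φ : V3 → ℝ, ContDiff ℝ (⊤ : ℕ∞) φ → ZPer φ →
      ∫ x in Set.Icc (0 : V3) 1, dot3 (u x) (grad3 φ x) = 0)
    {ε a b : ℝ} (hsupp : ∀ z, ε < ‖z‖ → k z = 0)
    (hfa : ∀ x z, ‖z‖ ≤ ε → |f x - f (x - z)| ≤ a)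
    (hub : ∀ x z, ‖z‖ ≤ ε → ‖u x - u (x - z)‖ ≤ b) :
    |∫ x in Set.Icc (0 : V3) 1, f x * dot3 (u x) (grad3 (mollify k f) x)|
      ≤ a ^ 2 * b * ∑ i, ∫ z, |pd i k z| := by
  have h4 := four_mul_energy_flux hk hkc heven hf hu hfp hup hdiv
  have hsupp' : ∀ i z, ε < ‖z‖ → pd i k z = 0 := by
    intro i z hz
    have hev : k =ᶠ[nhds z] fun _ => 0 :=
      Filter.eventually_of_mem ((isOpen_lt continuous_const continuous_norm).mem_nhds hz) hsupp
    rw [pd, hev.fderiv_eq]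
    simp
  have hbound : |∑ i, ∫ z, pd i k z *
      ∫ x in Set.Icc (0 : V3) 1, (f x - f (x - z)) ^ 2 * (u x i - u (x - z) i)|
      ≤ a ^ 2 * b * ∑ i, ∫ z, |pd i k z| := by
    rw [Finset.mul_sum]
    refine (Finset.abs_sum_le_sum_abs _ _).trans (Finset.sum_le_sum fun i _ => ?_)
    refine abs_integral_kernel_mul_le (continuous_pd hk i) (hasCompactSupport_pd hkc i)
      (hsupp' i) fun z hz => abs_setIntegral_cube_le fun x _ => ?_
    have h1 := hfa x z hz
    have h2 : |u x i - u (x - z) i| ≤ b := (norm_le_pi_norm (u x - u (x - z)) i).trans (hub x z hz)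
    rw [abs_mul, abs_pow]
    gcongr
  have h5 : 4 * |∫ x in Set.Icc (0 : V3) 1, f x * dot3 (u x) (grad3 (mollify k f) x)|
      ≤ a ^ 2 * b * ∑ i, ∫ z, |pd i k z| := by
    rw [← abs_neg] at hbound
    rwa [← h4, abs_mul, abs_of_pos (by norm_num : (0 : ℝ) < 4)] at hbound
  have := abs_nonneg (∫ x in Set.Icc (0 : V3) 1, f x * dot3 (u x) (grad3 (mollify k f) x))
  linarith

/-- A function with increments `|E s - E r| ≤ (s - r) (B + W (s - r) ^ a)` is `B`-Lipschitz. -/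
lemma abs_sub_le_of_increment_le {E : ℝ → ℝ} {B W a t : ℝ} (ha : 0 < a) (ht : 0 ≤ t)
    (h : ∀ r s, 0 ≤ r → r ≤ s → s ≤ t → |E s - E r| ≤ (s - r) * (B + W * (s - r) ^ a)) :
    |E t - E 0| ≤ t * B := by
  have hn : ∀ n : ℕ, |E t - E 0| ≤ t * (B + W * (t / ((n : ℝ) + 1)) ^ a) := by
    intro n
    have hn0 : (0 : ℝ) < (n : ℝ) + 1 := by positivity
    set δ := t / ((n : ℝ) + 1) with hδ
    have hδ0 : 0 ≤ δ := by positivity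
    have hδt : ((n : ℝ) + 1) * δ = t := by rw [hδ]; field_simp
    have hstep : ∀ m : ℕ, m ≤ n + 1 → |E (m * δ) - E 0| ≤ m * δ * (B + W * δ ^ a) := by
      intro m
      induction m with
      | zero => simp
      | succ m ih =>
        intro hm
        have h1 := ih (by omega)
        have hmt : ((m + 1 : ℕ) : ℝ) * δ ≤ t := by
          rw [← hδt]
          exact mul_le_mul_of_nonneg_right (by exact_mod_cast hm) hδ0
        have h2 := h (m * δ) ((m + 1 : ℕ) * δ) (by positivity) (by push_cast; nlinarith) hmt
        have hsub : ((m + 1 : ℕ) : ℝ) * δ - m * δ = δ := by push_cast; ring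
        rw [hsub] at h2
        have h3 := abs_sub_le (E ((m + 1 : ℕ) * δ)) (E (m * δ)) (E 0)
        push_cast at *
        linarith
    have := hstep (n + 1) le_rfl
    push_cast at this
    rwa [hδt] at this
  have h0 : Filter.Tendsto (fun n : ℕ => t / ((n : ℝ) + 1)) Filter.atTop (nhds 0) := by
    simpa [div_eq_mul_inv] using (tendsto_one_div_add_atTop_nhds_zero_nat (𝕜 := ℝ)).const_mul t
  have h1 := h0.rpow_const (p := a) (Or.inr ha.le)
  rw [Real.zero_rpow ha.ne'] at h1
  have h2 := ((h1.const_mul W).const_add B).const_mul t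
  rw [mul_zero, add_zero] at h2
  exact ge_of_tendsto' h2 hn

lemma setIntegral_mul_mollify {k f g : V3 → ℝ} (hk : Continuous k) (hkc : HasCompactSupport k)
    (hf : Continuous f) (hg : Continuous g) :
    ∫ x in Set.Icc (0 : V3) 1, f x * mollify k g x
      = ∫ z, k z * ∫ x in Set.Icc (0 : V3) 1, f x * g (x - z) := by
  rw [← setIntegral_integral_swap hk hkc (h := fun x z => f x * g (x - z)) (by fun_prop)]
  congr 1
  ext x
  rw [mollify, ← integral_const_mul]
  congr 1
  ext z
  ring

/-- Mollification with an even kernel is symmetric on periodic functions. -/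
lemma setIntegral_mul_mollify_comm {k f g : V3 → ℝ} (hk : Continuous k)
    (hkc : HasCompactSupport k) (heven : ∀ x, k (-x) = k x)
    (hf : Continuous f) (hg : Continuous g) (hfp : ZPer f) (hgp : ZPer g) :
    ∫ x in Set.Icc (0 : V3) 1, f x * mollify k g x
      = ∫ x in Set.Icc (0 : V3) 1, g x * mollify k f x := by
  rw [setIntegral_mul_mollify hk hkc hf hg, setIntegral_mul_mollify hk hkc hg hf,
    ← integral_neg_eq_self]
  congr 1
  ext z
  rw [heven, ← (hfp.mul (hgp.comp_sub (-z))).setIntegral_sub z]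
  congr 2
  ext x
  simp [mul_comm]

/-- The mollified energy of a weak solution changes at most at twice the rate allowed by the
energy flux. -/
lemma abs_mollified_energy_sub_le {k : V3 → ℝ} {ρ : ℝ → V3 → ℝ} {v : ℝ → V3 → V3}
    {T a C M B : ℝ}
    (hk : ContDiff ℝ (⊤ : ℕ∞) k) (hkc : HasCompactSupport k) (heven : ∀ x, k (-x) = k x)
    (hρ : ∀ t, Continuous (ρ t)) (hv : ∀ t, Continuous (v t)) (hρp : ∀ t, ZPer (ρ t))
    (hweak : ∀ ψ : V3 → ℝ, ContDiff ℝ (⊤ : ℕ∞) ψ → ZPer ψ → ∀ s t, 0 ≤ s → s ≤ t → t ≤ T →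
      (∫ x in Set.Icc (0 : V3) 1, ρ t x * ψ x) - (∫ x in Set.Icc (0 : V3) 1, ρ s x * ψ x)
        = ∫ r in s..t, ∫ x in Set.Icc (0 : V3) 1, ρ r x * dot3 (v r x) (grad3 ψ x))
    (ha : 0 < a) (hC : 0 ≤ C)
    (htime : ∀ r ∈ Set.Icc 0 T, ∀ t ∈ Set.Icc 0 T, ∀ x, |ρ t x - ρ r x| ≤ C * |t - r| ^ a)
    (hM : ∀ r ∈ Set.Icc 0 T, ∀ x ∈ Set.Icc (0 : V3) 1, |ρ r x| * ‖v r x‖ ≤ M)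
    (hB : ∀ r ∈ Set.Icc 0 T,
      |∫ x in Set.Icc (0 : V3) 1, ρ r x * dot3 (v r x) (grad3 (mollify k (ρ r)) x)| ≤ B)
    {t : ℝ} (ht : t ∈ Set.Icc 0 T) :
    |(∫ x in Set.Icc (0 : V3) 1, ρ t x * mollify k (ρ t) x)
      - ∫ x in Set.Icc (0 : V3) 1, ρ 0 x * mollify k (ρ 0) x| ≤ t * (2 * B) := by
  set h : ℝ → ℝ → ℝ := fun r s =>
    ∫ x in Set.Icc (0 : V3) 1, ρ r x * dot3 (v r x) (grad3 (mollify k (ρ s)) x) with hh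
  set L : ℝ := ∑ i, ∫ z, |pd i k z| with hL
  have hL0 : 0 ≤ L := Finset.sum_nonneg fun i _ => integral_nonneg fun z => abs_nonneg _
  have hM0 : 0 ≤ M := le_trans (by positivity)
    (hM 0 ⟨le_rfl, ht.1.trans ht.2⟩ 0 (Set.left_mem_Icc.2 zero_le_one))
  have hdiff : ∀ r ∈ Set.Icc 0 T, ∀ s ∈ Set.Icc 0 T,
      |h r s - h r r| ≤ M * (C * |s - r| ^ a) * L := by
    intro r hr s hs
    have e : h r s - h r r = ∑ i, ∫ z, pd i k z *
        ∫ x in Set.Icc (0 : V3) 1, ρ r x * v r x i * (ρ s (x - z) - ρ r (x - z)) := by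
      simp only [hh]
      rw [setIntegral_mul_dot3_grad3_mollify hk hkc (hρ r) (hρ s) (hv r),
        setIntegral_mul_dot3_grad3_mollify hk hkc (hρ r) (hρ r) (hv r),
        ← Finset.sum_sub_distrib]
      refine Finset.sum_congr rfl fun i _ => ?_
      have hvi : Continuous fun x => v r x i := (continuous_apply i).comp (hv r)
      have hp := (hρ r).mul hvi
      have hint : ∀ s, Integrable fun z => pd i k z *
          ∫ x in Set.Icc (0 : V3) 1, ρ r x * v r x i * ρ s (x - z) := fun s =>
        integrable_mul_of_hasCompactSupport (continuous_pd hk i) (hasCompactSupport_pd hkc i)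
          (continuous_setIntegral_mul_comp_sub hp (hρ s))
      rw [← integral_sub (hint s) (hint r)]
      congr 1
      ext z
      rw [← mul_sub, ← integral_sub]
      · simp_rw [mul_sub]
      · exact integrableOn_cube (hp.mul ((hρ s).comp (continuous_id.sub continuous_const)))
      · exact integrableOn_cube (hp.mul ((hρ r).comp (continuous_id.sub continuous_const)))
    rw [e, hL, Finset.mul_sum]
    refine (Finset.abs_sum_le_sum_abs _ _).trans (Finset.sum_le_sum fun i _ => ?_)
    obtain ⟨R, hR⟩ := (hasCompactSupport_pd hkc i).isBounded.exists_norm_le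
    refine abs_integral_kernel_mul_le (continuous_pd hk i) (hasCompactSupport_pd hkc i) (ε := R)
      (fun z hz => ?_) fun z _ => abs_setIntegral_cube_le fun x hx => ?_
    · by_contra hne
      exact absurd (hR z (subset_tsupport _ hne)) (not_le.2 hz)
    · rw [abs_mul, abs_mul]
      have h1 := norm_le_pi_norm (v r x) i
      rw [Real.norm_eq_abs] at h1
      refine mul_le_mul ((mul_le_mul_of_nonneg_left h1 (abs_nonneg _)).trans (hM r hr x hx))
        (htime r hr s hs _) (abs_nonneg _) hM0
  refine abs_sub_le_of_increment_le (E := fun t =>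
    ∫ x in Set.Icc (0 : V3) 1, ρ t x * mollify k (ρ t) x) (W := 2 * (M * C * L)) ha ht.1 ?_
  intro r s hr hrs hst
  have hw : ∀ q, (∫ x in Set.Icc (0 : V3) 1, ρ s x * mollify k (ρ q) x)
      - (∫ x in Set.Icc (0 : V3) 1, ρ r x * mollify k (ρ q) x) = ∫ p in r..s, h p q := fun q =>
    hweak _ (contDiff_mollify hk hkc (hρ q)) ((hρp q).mollify k) r s hr hrs (hst.trans ht.2)
  have hI : ∀ q ∈ Set.Icc r s,
      |∫ p in r..s, h p q| ≤ (B + M * (C * (s - r) ^ a) * L) * (s - r) := by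
    intro q hq
    have := intervalIntegral.norm_integral_le_of_norm_le_const (f := fun p => h p q) (a := r)
      (b := s) (C := B + M * (C * (s - r) ^ a) * L) fun p hp => ?_
    · rwa [abs_of_nonneg (sub_nonneg.2 hrs)] at this
    · rw [Set.uIoc_of_le hrs] at hp
      have hpT : p ∈ Set.Icc 0 T := ⟨hr.trans hp.1.le, hp.2.trans (hst.trans ht.2)⟩
      have hqT : q ∈ Set.Icc 0 T := ⟨hr.trans hq.1, hq.2.trans (hst.trans ht.2)⟩
      have h1 := hdiff p hpT q hqT
      have h2 := hB p hpT
      have h3 : |q - p| ^ a ≤ (s - r) ^ a :=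
        Real.rpow_le_rpow (abs_nonneg _)
          (abs_le.2 ⟨by linarith [hq.1, hp.2], by linarith [hq.2, hp.1]⟩) ha.le
      have h4 : M * (C * |q - p| ^ a) * L ≤ M * (C * (s - r) ^ a) * L := by gcongr
      have h5 : |h p q| ≤ |h p p| + |h p q - h p p| := by
        have := abs_add_le (h p p) (h p q - h p p)
        simpa using this
      rw [Real.norm_eq_abs]
      exact h5.trans (add_le_add h2 (h1.trans h4))
  have e : (∫ x in Set.Icc (0 : V3) 1, ρ s x * mollify k (ρ s) x)
      - (∫ x in Set.Icc (0 : V3) 1, ρ r x * mollify k (ρ r) x)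
      = (∫ p in r..s, h p s) + ∫ p in r..s, h p r := by
    rw [← hw s, ← hw r, setIntegral_mul_mollify_comm hk.continuous hkc heven (hρ r) (hρ s)
      (hρp r) (hρp s)]
    ring
  rw [e]
  refine (abs_add_le _ _).trans ?_
  have h1 := hI s ⟨hrs, le_rfl⟩
  have h2 := hI r ⟨le_rfl, hrs⟩
  calc _ ≤ _ := add_le_add h1 h2
    _ = _ := by ring

/-- Even smooth kernels concentrated at every scale `ε`, obtained by rescaling one bump
function without normalisation. -/
lemma exists_rescaled_kernels : ∃ I > (0 : ℝ), ∃ L : ℝ, ∀ ε > (0 : ℝ), ∃ k : V3 → ℝ,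
    ContDiff ℝ (⊤ : ℕ∞) k ∧ HasCompactSupport k ∧ (∀ x, k (-x) = k x) ∧
    (∀ z, ε < ‖z‖ → k z = 0) ∧ (∀ z, 0 ≤ k z) ∧ ∫ z, k z = ε ^ 3 * I ∧
    ∑ i, ∫ z, |pd i k z| = ε ^ 2 * L := by
  let φ : ContDiffBump (0 : V3) := ⟨1 / 2, 1, by norm_num, by norm_num⟩
  refine ⟨∫ z, φ z, φ.integral_pos, ∑ i, ∫ z, |pd i φ z|, fun ε hε => ?_⟩
  have hdim : Module.finrank ℝ V3 = 3 := by simp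
  refine ⟨fun z => φ (ε⁻¹ • z), φ.contDiff.comp (contDiff_const_smul _),
    φ.hasCompactSupport.comp_smul (inv_ne_zero hε.ne'), fun x => ?_, fun z hz => ?_,
    fun z => φ.nonneg, ?_, ?_⟩
  · simp only [smul_neg, φ.neg]
  · refine φ.zero_of_le_dist ?_
    rw [dist_zero_right, norm_smul, Real.norm_eq_abs, abs_of_pos (inv_pos.2 hε)]
    change 1 ≤ _
    rw [← div_eq_inv_mul, le_div_iff₀ hε]
    linarith
  · rw [Measure.integral_comp_inv_smul_of_nonneg volume (fun z => φ z) hε.le, hdim, smul_eq_mul]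
  · rw [Finset.mul_sum]
    refine Finset.sum_congr rfl fun i _ => ?_
    have hpd : ∀ z, pd i (fun z => φ (ε⁻¹ • z)) z = ε⁻¹ * pd i φ (ε⁻¹ • z) := by
      intro z
      rw [pd, fderiv_comp_smul]
      rfl
    simp_rw [hpd, abs_mul, abs_of_pos (inv_pos.2 hε)]
    rw [integral_const_mul,
      Measure.integral_comp_inv_smul_of_nonneg volume (fun z => |pd i φ z|) hε.le, hdim,
      smul_eq_mul]
    field_simp

lemma abs_mollified_energy_sub_energy_le {k f : V3 → ℝ} (hk : Continuous k)
    (hkc : HasCompactSupport k) (hf : Continuous f) {ε M c : ℝ} (hk0 : ∀ z, 0 ≤ k z)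
    (hM0 : 0 ≤ M) (hsupp : ∀ z, ε < ‖z‖ → k z = 0)
    (hM : ∀ x ∈ Set.Icc (0 : V3) 1, |f x| ≤ M)
    (hc : ∀ x z, ‖z‖ ≤ ε → |f x - f (x - z)| ≤ c) :
    |(∫ x in Set.Icc (0 : V3) 1, f x * mollify k f x)
      - (∫ z, k z) * ∫ x in Set.Icc (0 : V3) 1, f x * f x| ≤ M * c * ∫ z, k z := by
  have e : (∫ x in Set.Icc (0 : V3) 1, f x * mollify k f x)
      - (∫ z, k z) * (∫ x in Set.Icc (0 : V3) 1, f x * f x)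
      = ∫ z, k z * ∫ x in Set.Icc (0 : V3) 1, f x * (f (x - z) - f x) := by
    rw [setIntegral_mul_mollify hk hkc hf hf, ← integral_mul_const, ← integral_sub]
    · congr 1
      ext z
      rw [← mul_sub, ← integral_sub]
      · simp_rw [mul_sub]
      all_goals exact integrableOn_cube (by fun_prop)
    · exact integrable_mul_of_hasCompactSupport hk hkc
        (continuous_setIntegral_mul_comp_sub hf hf)
    · exact integrable_mul_of_hasCompactSupport hk hkc continuous_const
  rw [e]
  refine (abs_integral_kernel_mul_le hk hkc hsupp (C := M * c) fun z hz =>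
    abs_setIntegral_cube_le fun x hx => ?_).trans (le_of_eq ?_)
  · rw [abs_mul, abs_sub_comm]
    exact mul_le_mul (hM x hx) (hc x z hz) (abs_nonneg _) hM0
  · simp_rw [abs_of_nonneg (hk0 _)]

lemma ZPer.eq_zero_of_setIntegral_sq_eq_zero {f : V3 → ℝ} (hf : Continuous f) (hfp : ZPer f)
    (h : ∫ x in Set.Icc (0 : V3) 1, f x * f x = 0) (x : V3) : f x = 0 := by
  have hae := (setIntegral_eq_zero_iff_of_nonneg_ae
    (ae_of_all _ fun x => mul_self_nonneg (f x)) (integrableOn_cube (hf.mul hf))).1 h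
  have hint : (interior (Set.Icc (0 : V3) 1)).Nonempty := by
    rw [← Set.pi_univ_Icc, interior_pi_set Set.finite_univ]
    exact ⟨fun _ => 1 / 2, fun i _ => by norm_num [interior_Icc]⟩
  have heq := Measure.eqOn_of_ae_eq hae (hf.mul hf).continuousOn continuousOn_const
    (((convex_Icc (𝕜 := ℝ) (0 : V3) 1).closure_interior_eq_closure_of_nonempty_interior hint).symm ▸
      subset_closure)
  have hx := hfp (fun i => Int.fract (x i)) fun i => ⌊x i⌋
  have hx' : ((fun i => Int.fract (x i)) + fun i => (⌊x i⌋ : ℝ)) = x := by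
    ext i
    simp
  rw [hx'] at hx
  rw [hx]
  exact mul_self_eq_zero.1 (heq (x := fun i => Int.fract (x i))
    ⟨fun i => Int.fract_nonneg _, fun i => (Int.fract_lt_one _).le⟩)

/-- A weak solution of the transport equation with zero initial datum vanishes, provided the
regularity of the solution and of the velocity suffices for energy conservation. -/
theorem transport_eq_zero {ρ : ℝ → V3 → ℝ} {v : ℝ → V3 → V3} {T a b C D M : ℝ}
    (hρ : ∀ t, Continuous (ρ t)) (hv : ∀ t, Continuous (v t)) (hρp : ∀ t, ZPer (ρ t))
    (hvp : ∀ t i, ZPer fun x => v t x i)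
    (hdiv : ∀ t, ∀ φ : V3 → ℝ, ContDiff ℝ (⊤ : ℕ∞) φ → ZPer φ →
      ∫ x in Set.Icc (0 : V3) 1, dot3 (v t x) (grad3 φ x) = 0)
    (hweak : ∀ ψ : V3 → ℝ, ContDiff ℝ (⊤ : ℕ∞) ψ → ZPer ψ → ∀ s t, 0 ≤ s → s ≤ t → t ≤ T →
      (∫ x in Set.Icc (0 : V3) 1, ρ t x * ψ x) - (∫ x in Set.Icc (0 : V3) 1, ρ s x * ψ x)
        = ∫ r in s..t, ∫ x in Set.Icc (0 : V3) 1, ρ r x * dot3 (v r x) (grad3 ψ x))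
    (ha : 0 < a) (hb : 0 < b) (hab : 1 < b + 2 * a) (hC : 0 ≤ C) (hD : 0 ≤ D)
    (htime : ∀ r ∈ Set.Icc 0 T, ∀ t ∈ Set.Icc 0 T, ∀ x, |ρ t x - ρ r x| ≤ C * |t - r| ^ a)
    (hspace : ∀ r ∈ Set.Icc 0 T, ∀ x y, |ρ r x - ρ r y| ≤ C * ‖x - y‖ ^ a)
    (hvspace : ∀ r ∈ Set.Icc 0 T, ∀ x y, ‖v r x - v r y‖ ≤ D * ‖x - y‖ ^ b)
    (hM : ∀ r ∈ Set.Icc 0 T, ∀ x ∈ Set.Icc (0 : V3) 1, |ρ r x| * ‖v r x‖ ≤ M)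
    (hzero : ∀ x, ρ 0 x = 0) {t : ℝ} (ht : t ∈ Set.Icc 0 T) (x : V3) : ρ t x = 0 := by
  obtain ⟨I, hI, L, hkern⟩ := exists_rescaled_kernels
  obtain ⟨N, hN⟩ := (isCompact_Icc (a := (0 : V3)) (b := 1)).exists_bound_of_continuousOn
    (hρ t).continuousOn
  have hN0 : 0 ≤ N := (norm_nonneg _).trans (hN 0 (Set.left_mem_Icc.2 zero_le_one))
  set S := ∫ x in Set.Icc (0 : V3) 1, ρ t x * ρ t x with hS
  have hS0 : 0 ≤ S := integral_nonneg fun x => mul_self_nonneg _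
  have hbound : ∀ ε > (0 : ℝ), I * S ≤
      N * C * I * ε ^ a + 2 * t * C ^ 2 * D * L * ε ^ (b + 2 * a - 1) := by
    intro ε hε
    obtain ⟨k, hk, hkc, heven, hsupp, hk0, hkI, hkL⟩ := hkern ε hε
    have hinc : ∀ r ∈ Set.Icc 0 T, ∀ x z, ‖z‖ ≤ ε → |ρ r x - ρ r (x - z)| ≤ C * ε ^ a := by
      intro r hr x z hz
      refine (hspace r hr x (x - z)).trans ?_
      rw [sub_sub_cancel]
      gcongr
    have hvinc : ∀ r ∈ Set.Icc 0 T, ∀ x z, ‖z‖ ≤ ε → ‖v r x - v r (x - z)‖ ≤ D * ε ^ b := by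
      intro r hr x z hz
      refine (hvspace r hr x (x - z)).trans ?_
      rw [sub_sub_cancel]
      gcongr
    have h1 := abs_mollified_energy_sub_le hk hkc heven hρ hv hρp hweak ha hC htime hM
      (B := (C * ε ^ a) ^ 2 * (D * ε ^ b) * (ε ^ 2 * L)) (fun r hr => by
        rw [← hkL]
        exact abs_energy_flux_le hk hkc heven (hρ r) (hv r) (hρp r) (hvp r) (hdiv r) hsupp
          (hinc r hr) (hvinc r hr)) ht
    have h2 := abs_mollified_energy_sub_energy_le hk.continuous hkc (hρ t) hk0 hN0 hsupp hN
      (hinc t ht)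
    simp only [hzero, zero_mul, integral_zero, sub_zero] at h1
    rw [hkI, ← hS] at h2
    have h3 : ε ^ 3 * I * S ≤ N * (C * ε ^ a) * (ε ^ 3 * I)
        + t * (2 * ((C * ε ^ a) ^ 2 * (D * ε ^ b) * (ε ^ 2 * L))) := by
      have := (abs_le.1 h1).2
      have := (abs_le.1 h2).1
      linarith
    have hpow : (ε ^ a) ^ 2 * ε ^ b * ε ^ 2 = ε ^ (b + 2 * a - 1) * ε ^ 3 := by
      rw [← Real.rpow_natCast (ε ^ a), ← Real.rpow_mul hε.le, ← Real.rpow_natCast ε 2,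
        ← Real.rpow_natCast ε 3, ← Real.rpow_add hε, ← Real.rpow_add hε, ← Real.rpow_add hε]
      congr 1
      push_cast
      ring
    refine le_of_mul_le_mul_left ?_ (pow_pos hε 3)
    calc ε ^ 3 * (I * S) = ε ^ 3 * I * S := by ring
      _ ≤ _ := h3
      _ = ε ^ 3 * (N * C * I * ε ^ a)
          + 2 * t * C ^ 2 * D * L * ((ε ^ a) ^ 2 * ε ^ b * ε ^ 2) := by ring
      _ = _ := by rw [hpow]; ring
  have hlim : ∀ p : ℝ, 0 < p →
      Filter.Tendsto (fun ε : ℝ => ε ^ p) (nhdsWithin 0 (Set.Ioi 0)) (nhds 0) := by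
    intro p hp
    have := (Real.continuousAt_rpow_const 0 p (Or.inr hp.le)).tendsto
    rw [Real.zero_rpow hp.ne'] at this
    exact this.mono_left nhdsWithin_le_nhds
  have hlim2 := ((hlim a ha).const_mul (N * C * I)).add
    ((hlim (b + 2 * a - 1) (by linarith)).const_mul (2 * t * C ^ 2 * D * L))
  rw [mul_zero, mul_zero, add_zero] at hlim2
  have hIS : I * S ≤ 0 := ge_of_tendsto hlim2
    (Filter.eventually_of_mem self_mem_nhdsWithin hbound)
  have hSz : S = 0 := le_antisymm (nonpos_of_mul_nonpos_right hIS hI) hS0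
  exact ZPer.eq_zero_of_setIntegral_sq_eq_zero (hρ t) (hρp t) hSz x

/-- Freezing the time variable outside `[0,T]` extends continuous functions on the strip. -/
lemma ContinuousOn.continuous_clamp {Y : Type*} [TopologicalSpace Y] {g : ℝ × V3 → Y} {T : ℝ}
    (hT : 0 ≤ T) (hg : ContinuousOn g (Set.Icc (0 : ℝ) T ×ˢ Set.univ)) :
    Continuous fun p : ℝ × V3 => g (max 0 (min p.1 T), p.2) :=
  hg.comp_continuous (by fun_prop)
    fun p => ⟨⟨le_max_left _ _, max_le hT (min_le_right _ _)⟩, trivial⟩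

section Pairing

variable {T : ℝ} {v : ℝ × V3 → V3} {ρ : ℝ × V3 → ℝ} {ψ : V3 → ℝ}

lemma continuous_transport_integrand_uncurry
    (hv : Continuous fun p : ℝ × V3 => v (max 0 (min p.1 T), p.2))
    (hρ : Continuous fun p : ℝ × V3 => ρ (max 0 (min p.1 T), p.2))
    (hψ : ContDiff ℝ (⊤ : ℕ∞) ψ) :
    Continuous (Function.uncurry fun (r : ℝ) (x : V3) =>
      ρ (max 0 (min r T), x) * dot3 (v (max 0 (min r T), x)) (grad3 ψ x)) := by
  refine hρ.mul (continuous_finsetSum _ fun i _ => ?_)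
  exact ((continuous_apply i).comp hv).mul ((continuous_pd hψ i).comp continuous_snd)

lemma continuous_transport_integrand
    (hv : Continuous fun p : ℝ × V3 => v (max 0 (min p.1 T), p.2))
    (hρ : Continuous fun p : ℝ × V3 => ρ (max 0 (min p.1 T), p.2))
    (hψ : ContDiff ℝ (⊤ : ℕ∞) ψ) (r : ℝ) :
    Continuous fun x : V3 =>
      ρ (max 0 (min r T), x) * dot3 (v (max 0 (min r T), x)) (grad3 ψ x) :=
  (continuous_transport_integrand_uncurry hv hρ hψ).comp
    (continuous_const.prodMk continuous_id : Continuous fun x : V3 => (r, x))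

lemma continuous_transport_pairing
    (hv : Continuous fun p : ℝ × V3 => v (max 0 (min p.1 T), p.2))
    (hρ : Continuous fun p : ℝ × V3 => ρ (max 0 (min p.1 T), p.2))
    (hψ : ContDiff ℝ (⊤ : ℕ∞) ψ) :
    Continuous fun r : ℝ => ∫ x in Set.Icc (0 : V3) 1,
      ρ (max 0 (min r T), x) * dot3 (v (max 0 (min r T), x)) (grad3 ψ x) :=
  continuous_setIntegral_cube (continuous_transport_integrand_uncurry hv hρ hψ)

/-- The weak formulation tested with a time-independent function on a subinterval. -/
lemma IsWeakTransportSol.increment_eq (hsol : IsWeakTransportSol T v ρ) (hT : 0 ≤ T)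
    (hv : ContinuousOn v (Set.Icc (0 : ℝ) T ×ˢ Set.univ))
    (hρ : ContinuousOn ρ (Set.Icc (0 : ℝ) T ×ˢ Set.univ))
    (hψ : ContDiff ℝ (⊤ : ℕ∞) ψ) (hψp : ZPer ψ) {s t : ℝ} (hs : 0 ≤ s) (hst : s ≤ t)
    (ht : t ≤ T) :
    (∫ x in Set.Icc (0 : V3) 1, ρ (max 0 (min t T), x) * ψ x)
      - (∫ x in Set.Icc (0 : V3) 1, ρ (max 0 (min s T), x) * ψ x)
      = ∫ r in s..t, ∫ x in Set.Icc (0 : V3) 1,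
          ρ (max 0 (min r T), x) * dot3 (v (max 0 (min r T), x)) (grad3 ψ x) := by
  have hclamp_eq : ∀ t ∈ Set.Icc 0 T, max 0 (min t T) = t := fun t ht => by
    rw [min_eq_left ht.2, max_eq_right ht.1]
  have hJ := continuous_transport_pairing (hv.continuous_clamp hT) (hρ.continuous_clamp hT) hψ
  have h0 : ∀ q ∈ Set.Icc 0 T, (∫ r in (0 : ℝ)..q, ∫ x in Set.Icc (0 : V3) 1,
      ρ (max 0 (min r T), x) * dot3 (v (max 0 (min r T), x)) (grad3 ψ x))
      = (∫ x in Set.Icc (0 : V3) 1, ρ (max 0 (min q T), x) * ψ x)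
        - ∫ x in Set.Icc (0 : V3) 1, ρ (0, x) * ψ x := by
    intro q hq
    have h := hsol (fun p => ψ p.2) (hψ.comp contDiff_snd) (fun _ x n => hψp x n) q hq
    simp only [deriv_const, mul_zero, zero_add] at h
    rw [hclamp_eq q hq, ← h]
    refine intervalIntegral.integral_congr fun r hr => ?_
    rw [Set.uIcc_of_le hq.1] at hr
    simp only [hclamp_eq r ⟨hr.1, hr.2.trans hq.2⟩]
  rw [← intervalIntegral.integral_interval_sub_left (hJ.intervalIntegrable 0 t)
    (hJ.intervalIntegrable 0 s), h0 t ⟨hs.trans hst, ht⟩, h0 s ⟨hs, hst.trans ht⟩]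
  ring

end Pairing

/-- **Uniqueness of Hölder weak solutions of the transport equation.**
Let `β, β̃ ∈ (0,1)` with `β + 2β̃ > 1`.  For any divergence-free
`v ∈ C^β([0,T] × 𝕋³; ℝ³)`, the transport equation `∂_t ρ + div (v ρ) = 0` with given
initial data admits at most one weak solution in `C^{β̃}([0,T] × 𝕋³)`. -/
theorem transport_uniqueness
    (T : ℝ) (hT : 0 < T) (β bt : ℝ≥0)
    (hβ0 : 0 < β) (hβ1 : β < 1) (hbt0 : 0 < bt) (hbt1 : bt < 1)
    (hreg : 1 < (β : ℝ) + 2 * (bt : ℝ))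
    (v : ℝ × V3 → V3) (ρ₁ ρ₂ : ℝ × V3 → ℝ)
    (hvH : ∃ C : ℝ≥0, HolderOnWith C β v (Set.Icc (0:ℝ) T ×ˢ Set.univ))
    (hρ₁H : ∃ C : ℝ≥0, HolderOnWith C bt ρ₁ (Set.Icc (0:ℝ) T ×ˢ Set.univ))
    (hρ₂H : ∃ C : ℝ≥0, HolderOnWith C bt ρ₂ (Set.Icc (0:ℝ) T ×ˢ Set.univ))
    (hvper : ZPerSTv v) (hρ₁per : ZPerST ρ₁) (hρ₂per : ZPerST ρ₂)
    (hdiv : WeaklyDivFree v)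
    (hsol₁ : IsWeakTransportSol T v ρ₁)
    (hsol₂ : IsWeakTransportSol T v ρ₂)
    (hinit : ∀ x : V3, ρ₁ (0, x) = ρ₂ (0, x)) :
    ∀ t ∈ Set.Icc (0 : ℝ) T, ∀ x : V3, ρ₁ (t, x) = ρ₂ (t, x) := by
  obtain ⟨D, hD⟩ := hvH
  obtain ⟨C₁, hC₁⟩ := hρ₁H
  obtain ⟨C₂, hC₂⟩ := hρ₂H
  have hvc := hD.continuousOn hβ0
  have h1c := hC₁.continuousOn hbt0
  have h2c := hC₂.continuousOn hbt0
  have hclamp_eq : ∀ t ∈ Set.Icc 0 T, max 0 (min t T) = t := fun t ht => by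
    rw [min_eq_left ht.2, max_eq_right ht.1]
  have hV := hvc.continuous_clamp hT.le
  have hR₁ := h1c.continuous_clamp hT.le
  have hR₂ := h2c.continuous_clamp hT.le
  have hslice : ∀ t : ℝ, Continuous fun x : V3 => (t, x) := fun t => by fun_prop
  obtain ⟨M, hM⟩ := ((isCompact_Icc (a := (0 : ℝ)) (b := T)).prod
    (isCompact_Icc (a := (0 : V3)) (b := 1))).exists_bound_of_continuousOn
    (((hR₁.sub hR₂).abs.mul hV.norm).continuousOn)
  have hinc : ∀ p ∈ Set.Icc (0 : ℝ) T ×ˢ (Set.univ : Set V3),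
      ∀ q ∈ Set.Icc (0 : ℝ) T ×ˢ (Set.univ : Set V3),
      |(ρ₁ p - ρ₂ p) - (ρ₁ q - ρ₂ q)| ≤ ((C₁ : ℝ) + C₂) * dist p q ^ (bt : ℝ) := by
    intro p hp q hq
    have h1 := hC₁.dist_le hp hq
    have h2 := hC₂.dist_le hp hq
    rw [Real.dist_eq] at h1 h2
    calc |(ρ₁ p - ρ₂ p) - (ρ₁ q - ρ₂ q)| = |(ρ₁ p - ρ₁ q) - (ρ₂ p - ρ₂ q)| := by congr 1; ring
      _ ≤ |ρ₁ p - ρ₁ q| + |ρ₂ p - ρ₂ q| := abs_sub _ _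
      _ ≤ _ := by rw [add_mul]; exact add_le_add h1 h2
  intro t ht x
  have key := transport_eq_zero
    (ρ := fun t x => ρ₁ (max 0 (min t T), x) - ρ₂ (max 0 (min t T), x))
    (v := fun t x => v (max 0 (min t T), x)) (T := T) (a := bt) (b := β) (C := (C₁ : ℝ) + C₂)
    (D := D) (M := M)
    (fun t => (hR₁.comp (hslice t)).sub (hR₂.comp (hslice t)))
    (fun t => hV.comp (hslice t))
    (fun t x n => by simp only [hρ₁per _ x n, hρ₂per _ x n])
    (fun t i x n => by simp only [hvper _ x n])
    (fun t φ hφ hφp => hdiv _ φ hφ hφp)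
    (fun ψ hψ hψp s t hs hst htT => by
      have e₁ := hsol₁.increment_eq hT.le hvc h1c hψ hψp hs hst htT
      have e₂ := hsol₂.increment_eq hT.le hvc h2c hψ hψp hs hst htT
      have hψc := hψ.continuous
      have hint : ∀ {ρ : ℝ × V3 → ℝ},
          Continuous (fun p : ℝ × V3 => ρ (max 0 (min p.1 T), p.2)) → ∀ r : ℝ,
          IntegrableOn (fun x => ρ (max 0 (min r T), x) * ψ x) (Set.Icc (0 : V3) 1) :=
        fun h r => integrableOn_cube ((h.comp (hslice r)).mul hψc)
      have hJ₁ := continuous_transport_pairing hV hR₁ hψ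
      have hJ₂ := continuous_transport_pairing hV hR₂ hψ
      simp_rw [sub_mul]
      rw [integral_sub (hint hR₁ t) (hint hR₂ t), integral_sub (hint hR₁ s) (hint hR₂ s)]
      rw [sub_sub_sub_comm, e₁, e₂, ← intervalIntegral.integral_sub (hJ₁.intervalIntegrable _ _)
        (hJ₂.intervalIntegrable _ _)]
      congr 1
      ext r
      exact (integral_sub (integrableOn_cube (continuous_transport_integrand hV hR₁ hψ r))
        (integrableOn_cube (continuous_transport_integrand hV hR₂ hψ r))).symm)
    (by exact_mod_cast hbt0) (by exact_mod_cast hβ0) hreg (by positivity) (by positivity)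
    (fun r hr t ht x => by
      have := hinc (t, x) ⟨ht, trivial⟩ (r, x) ⟨hr, trivial⟩
      simpa [hclamp_eq r hr, hclamp_eq t ht, Prod.dist_eq, Real.dist_eq] using this)
    (fun r hr x y => by
      have := hinc (r, x) ⟨hr, trivial⟩ (r, y) ⟨hr, trivial⟩
      simpa [hclamp_eq r hr, Prod.dist_eq, dist_eq_norm] using this)
    (fun r hr x y => by
      have := hD.dist_le (x := (r, x)) ⟨hr, trivial⟩ (y := (r, y)) ⟨hr, trivial⟩
      simpa [hclamp_eq r hr, Prod.dist_eq, dist_eq_norm] using this)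
    (fun r hr x hx => (le_abs_self _).trans (hM (r, x) ⟨hr, hx⟩))
    (fun x => by rw [hclamp_eq 0 ⟨le_rfl, hT.le⟩, hinit, sub_self]) ht x
  rw [hclamp_eq t ht] at key
  exact sub_eq_zero.1 key
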